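/- arXiv:2404.04181 — 4 statements merged into one kernel-verified Lean document; each statement's English description precedes it below -/
import Mathlib

section
/- Let ρ > 0 and τ > 0, and let S, I : ℝ → ℝ be differentiable functions satisfying S'(t) = -ρ S(t) I(t)/τ and I'(t) = (ρ S(t) I(t) - I(t))/τ for all t ∈ ℝ, with S(t) > 0 for all t. Assume moreover that S(t) → 1 and I(t) → 0 as t → -∞. Then for every t₀ ∈ ℝ, I(t₀) = 1 - S(t₀) + (1/ρ) · ln(S(t₀)). -/
open Filter

/-- For an SIR solution with `S > 0`, `S(t) → 1` and `I(t) → 0` as `t → -∞`,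
one has `I(t₀) = 1 - S(t₀) + (1/ρ) ln(S(t₀))` for every `t₀`. -/
theorem sir_I_from_S (ρ τ : ℝ) (hρ : 0 < ρ) (hτ : 0 < τ) (S I : ℝ → ℝ)
    (hS : Differentiable ℝ S) (hI : Differentiable ℝ I)
    (hS' : ∀ t, deriv S t = -ρ * S t * I t / τ)
    (hI' : ∀ t, deriv I t = (ρ * S t * I t - I t) / τ)
    (hSpos : ∀ t, 0 < S t)
    (hSlim : Tendsto S atBot (nhds 1))
    (hIlim : Tendsto I atBot (nhds 0)) :
    ∀ t₀ : ℝ, I t₀ = 1 - S t₀ + (1 / ρ) * Real.log (S t₀) := by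
  intro t₀
  have hd : ∀ t, HasDerivAt (fun t => I t + S t - (1 / ρ) * Real.log (S t)) 0 t := by
    intro t
    have h1 := (hI t).hasDerivAt
    have h2 := (hS t).hasDerivAt
    have h3 := (h1.add h2).sub ((h2.log (hSpos t).ne').const_mul (1 / ρ))
    rw [hI', hS'] at h3
    have e : (ρ * S t * I t - I t) / τ + -ρ * S t * I t / τ
        - 1 / ρ * (-ρ * S t * I t / τ / S t) = 0 := by
      have := (hSpos t).ne'
      field_simp
      ring
    rw [e] at h3
    exact h3
  have hc : ∀ t, I t + S t - (1 / ρ) * Real.log (S t)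
      = I t₀ + S t₀ - (1 / ρ) * Real.log (S t₀) := fun t =>
    is_const_of_deriv_eq_zero (fun x => (hd x).differentiableAt) (fun x => (hd x).deriv) t t₀
  have hl : Tendsto (fun t => I t + S t - (1 / ρ) * Real.log (S t)) atBot
      (nhds (0 + 1 - (1 / ρ) * Real.log 1)) :=
    (hIlim.add hSlim).sub ((hSlim.log one_ne_zero).const_mul (1 / ρ))
  simp only [hc] at hl
  have := tendsto_nhds_unique hl tendsto_const_nhds
  rw [Real.log_one] at this
  linarith
end

section
/- Let ρ > 0 and τ > 0, and let S, I : ℝ → ℝ be differentiable functions satisfying S'(t) = -ρ S(t) I(t)/τ and I'(t) = (ρ S(t) I(t) - I(t))/τ for all t ∈ ℝ, with S(t) > 0 for all t. Assume that S(t) → 1 and I(t) → 0 as t → -∞, and that S(t) → S∞ and I(t) → 0 as t → +∞, where S∞ ∈ (0,1). Then ρ = ln(S∞)/(S∞ - 1) (the final size relation: the final size Δ = 1 - S∞ of the outbreak is determined by ρ alone). -/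
open Filter

/-- final size relation: For an SIR solution with `S > 0`,
`S → 1` and `I → 0` as `t → -∞`, and `S → S∞ ∈ (0,1)` and `I → 0` as `t → +∞`,
one has `ρ = ln(S∞)/(S∞ - 1)`. -/
theorem sir_final_size_relation (ρ τ : ℝ) (hρ : 0 < ρ) (hτ : 0 < τ) (S I : ℝ → ℝ)
    (hS : Differentiable ℝ S) (hI : Differentiable ℝ I)
    (hS' : ∀ t, deriv S t = -ρ * S t * I t / τ)
    (hI' : ∀ t, deriv I t = (ρ * S t * I t - I t) / τ)
    (hSpos : ∀ t, 0 < S t)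
    (hSlim : Tendsto S atBot (nhds 1))
    (hIlim : Tendsto I atBot (nhds 0))
    (Sinf : ℝ) (hSinf : Sinf ∈ Set.Ioo (0 : ℝ) 1)
    (hSlim' : Tendsto S atTop (nhds Sinf))
    (hIlim' : Tendsto I atTop (nhds 0)) :
    ρ = Real.log Sinf / (Sinf - 1) := by
  have hd : ∀ t, HasDerivAt (fun t => ρ * (S t + I t) - Real.log (S t)) 0 t := by
    intro t
    have h1 := (hS t).hasDerivAt
    have h2 := (hI t).hasDerivAt
    have h3 := ((h1.add h2).const_mul ρ).sub (h1.log (hSpos t).ne')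
    refine h3.congr_deriv ?_
    have := (hSpos t).ne'
    rw [hS', hI']
    field_simp
    ring
  have hc : ∀ t, ρ * (S t + I t) - Real.log (S t) = ρ * (S 0 + I 0) - Real.log (S 0) :=
    fun t => is_const_of_deriv_eq_zero (fun t => (hd t).differentiableAt)
      (fun t => (hd t).deriv) t 0
  have l1 := ((hSlim.add hIlim).const_mul ρ).sub (hSlim.log one_ne_zero)
  have l2 := ((hSlim'.add hIlim').const_mul ρ).sub (hSlim'.log hSinf.1.ne')
  simp only [hc] at l1 l2
  have e1 := tendsto_nhds_unique l1 tendsto_const_nhds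
  have e2 := tendsto_nhds_unique l2 tendsto_const_nhds
  rw [Real.log_one] at e1
  have hne : Sinf - 1 ≠ 0 := (sub_neg.mpr hSinf.2).ne
  rw [eq_div_iff hne]
  linarith
end

section
/- (Theorem 1: for every ρ > 1 there is a good fit to any target triple.) Fix ρ > 1. Assume there exists a nonconstant solution (S, I) of the SIR model with parameters ρ and τ = 1 (i.e., S'(t) = -ρ S(t) I(t), I'(t) = ρ S(t) I(t) - I(t), S(t) → 1 as t → -∞) such that -S' is nonnegative, the functions -S', t ↦ -t·S'(t), t ↦ -t²·S'(t) are integrable, ∫ℝ (-S'(t)) dt > 0, the mean time of -S' is 0, and its standard deviation σ₁ satisfies 0 < σ₁ < ∞. Then for every target triple (A_f, μ_f, σ_f) with A_f > 0, μ_f ∈ ℝ, σ_f > 0, there exist A > 0, τ > 0 and a solution (S₁, I₁) of the SIR model with parameters ρ and τ such that the function g(t) := -A·S₁'(t) satisfies ∫ℝ g = A_f, the mean time of g is μ_f, and the standard deviation of g is σ_f (i.e., g is a good fit to the target triple). -/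
open Filter MeasureTheory

/-- The mean time of a mass density `f` on `ℝ`. -/
noncomputable def meanTime (f : ℝ → ℝ) : ℝ := (∫ t, t * f t) / (∫ t, f t)

/-- The standard deviation of a mass density `f` on `ℝ`. -/
noncomputable def stdDev (f : ℝ → ℝ) : ℝ :=
  Real.sqrt ((∫ t, (t - meanTime f) ^ 2 * f t) / (∫ t, f t))

lemma comp_aux (G : ℝ → ℝ) (μ τ : ℝ) (hτ : 0 < τ) :
    (∫ t, G ((t - μ) / τ)) = τ * ∫ t, G t := by
  have h1 := integral_sub_right_eq_self (μ := volume) (fun t => G (t / τ)) μ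
  rw [h1, Measure.integral_comp_div G τ, abs_of_pos hτ, smul_eq_mul]

lemma comp_int_aux (G : ℝ → ℝ) (μ τ : ℝ) (hτ : 0 < τ) (hG : Integrable G) :
    Integrable (fun t => G ((t - μ) / τ)) :=
  (hG.comp_div hτ.ne').comp_sub_right μ

/-- Theorem 1: Fix `ρ > 1`. If there is a nonconstant SIR solution with
parameters `ρ, τ = 1` whose incidence `-S'` is a nonnegative integrable density with
positive total mass, mean time `0` and standard deviation `σ₁ ∈ (0,∞)`, then for every
target triple `(A_f, μ_f, σ_f)` there exist `A > 0`, `τ > 0` and an SIR solution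
`(S₁, I₁)` with parameters `ρ, τ` such that `g = -A·S₁'` is a good fit:
`∫ g = A_f`, `meanTime g = μ_f` and `stdDev g = σ_f`. -/
theorem sir_good_fit_exists (ρ : ℝ) (hρ : 1 < ρ) (S I : ℝ → ℝ)
    (hS : Differentiable ℝ S) (hI : Differentiable ℝ I)
    (hS' : ∀ t, deriv S t = -ρ * S t * I t)
    (hI' : ∀ t, deriv I t = ρ * S t * I t - I t)
    (hSlim : Tendsto S atBot (nhds 1))
    (hnc : ∃ t₁ t₂, S t₁ ≠ S t₂ ∨ I t₁ ≠ I t₂)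
    (hnn : ∀ t, 0 ≤ -deriv S t)
    (hint0 : Integrable (fun t => -deriv S t))
    (hint1 : Integrable (fun t => -(t * deriv S t)))
    (hint2 : Integrable (fun t => -(t ^ 2 * deriv S t)))
    (hpos : 0 < ∫ t, -deriv S t)
    (hmean : meanTime (fun t => -deriv S t) = 0)
    (σ₁ : ℝ) (hσ₁ : 0 < σ₁) (hsd : stdDev (fun t => -deriv S t) = σ₁)
    (Af μf σf : ℝ) (hAf : 0 < Af) (hσf : 0 < σf) :
    ∃ (A τ : ℝ) (S₁ I₁ : ℝ → ℝ), 0 < A ∧ 0 < τ ∧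
      Differentiable ℝ S₁ ∧ Differentiable ℝ I₁ ∧
      (∀ t, deriv S₁ t = -ρ * S₁ t * I₁ t / τ) ∧
      (∀ t, deriv I₁ t = (ρ * S₁ t * I₁ t - I₁ t) / τ) ∧
      Tendsto S₁ atBot (nhds 1) ∧
      (∀ t, 0 ≤ A * -deriv S₁ t) ∧
      Integrable (fun t => A * -deriv S₁ t) ∧
      Integrable (fun t => t * (A * -deriv S₁ t)) ∧
      Integrable (fun t => t ^ 2 * (A * -deriv S₁ t)) ∧
      (∫ t, A * -deriv S₁ t) = Af ∧
      meanTime (fun t => A * -deriv S₁ t) = μf ∧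
      stdDev (fun t => A * -deriv S₁ t) = σf := by
  set M := ∫ t, -deriv S t with hM
  have hτ : 0 < σf / σ₁ := div_pos hσf hσ₁
  have hτσ : σf / σ₁ * σ₁ = σf := by field_simp
  set τ := σf / σ₁ with hτdef
  have hA : 0 < Af / M := div_pos hAf hpos
  have hAM : Af / M * M = Af := by field_simp
  set A := Af / M with hAdef
  set h : ℝ → ℝ := fun t => -deriv S t with hh
  have hlin : ∀ t, HasDerivAt (fun t => (t - μf) / τ) (1 / τ) t := fun t =>
    ((hasDerivAt_id t).sub_const μf).div_const τ
  have hdS : ∀ t, HasDerivAt (fun t => S ((t - μf) / τ))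
      (deriv S ((t - μf) / τ) * (1 / τ)) t := fun t =>
    HasDerivAt.comp t (hS _).hasDerivAt (hlin t)
  have hdI : ∀ t, HasDerivAt (fun t => I ((t - μf) / τ))
      (deriv I ((t - μf) / τ) * (1 / τ)) t := fun t =>
    HasDerivAt.comp t (hI _).hasDerivAt (hlin t)
  have i0 : Integrable h := hint0
  have i1 : Integrable (fun t => t * h t) := by
    refine hint1.congr (Eventually.of_forall fun t => ?_)
    simp only [hh]; ring
  have i2 : Integrable (fun t => t ^ 2 * h t) := by
    refine hint2.congr (Eventually.of_forall fun t => ?_)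
    simp only [hh]; ring
  have m1 : ∫ t, t * h t = 0 := by
    have := hmean
    unfold meanTime at this
    rcases div_eq_zero_iff.1 this with h1 | h1
    · exact h1
    · exact absurd h1 hpos.ne'
  have m2 : ∫ t, t ^ 2 * h t = σ₁ ^ 2 * M := by
    have h1 := hsd
    unfold stdDev at h1
    rw [hmean] at h1
    simp only [sub_zero] at h1
    have h2 : 0 ≤ (∫ t, t ^ 2 * h t) / M :=
      div_nonneg (integral_nonneg fun t => mul_nonneg (sq_nonneg t) (hnn t)) hpos.le
    have h3 : (∫ t, t ^ 2 * h t) / M = σ₁ ^ 2 := by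
      rw [← h1, Real.sq_sqrt h2]
    rw [← h3]; field_simp
  have hF : (fun t => A * -deriv (fun t => S ((t - μf) / τ)) t)
      = fun t => (A / τ) * h ((t - μf) / τ) := by
    funext t
    rw [(hdS t).deriv]; simp only [hh]; ring
  have e0 : (fun t => A * -deriv (fun t => S ((t - μf) / τ)) t)
      = fun t => (fun s => (A / τ) * h s) ((t - μf) / τ) := hF
  have e1 : (fun t => t * (A * -deriv (fun t => S ((t - μf) / τ)) t))
      = fun t => (fun s => A * (s * h s) + μf * (A / τ) * h s) ((t - μf) / τ) := by
    funext t
    have := congrFun hF t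
    simp only at this ⊢
    rw [this]; field_simp; ring
  have e2 : (fun t => t ^ 2 * (A * -deriv (fun t => S ((t - μf) / τ)) t))
      = fun t => (fun s => A * τ * (s ^ 2 * h s) + 2 * μf * A * (s * h s)
          + μf ^ 2 * (A / τ) * h s) ((t - μf) / τ) := by
    funext t
    have := congrFun hF t
    simp only at this ⊢
    rw [this]; field_simp; ring
  have e3 : (fun t => (t - μf) ^ 2 * (A * -deriv (fun t => S ((t - μf) / τ)) t))
      = fun t => (fun s => A * τ * (s ^ 2 * h s)) ((t - μf) / τ) := by
    funext t
    have := congrFun hF t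
    simp only at this ⊢
    rw [this]; field_simp
  have v0 : (∫ t, A * -deriv (fun t => S ((t - μf) / τ)) t) = Af := by
    rw [e0]
    refine (comp_aux (fun s => (A / τ) * h s) μf τ hτ).trans ?_
    rw [ integral_const_mul, ← hAM, hM]
    field_simp
  have v1 : (∫ t, t * (A * -deriv (fun t => S ((t - μf) / τ)) t)) = μf * Af := by
    rw [e1]
    refine (comp_aux (fun s => A * (s * h s) + μf * (A / τ) * h s) μf τ hτ).trans ?_
    rw [ integral_add (i1.const_mul _) (i0.const_mul _),
      integral_const_mul, integral_const_mul, m1, ← hAM, hM]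
    field_simp; ring
  have v3 : (∫ t, (t - μf) ^ 2 * (A * -deriv (fun t => S ((t - μf) / τ)) t))
      = σf ^ 2 * Af := by
    rw [e3]
    refine (comp_aux (fun s => A * τ * (s ^ 2 * h s)) μf τ hτ).trans ?_
    rw [ integral_const_mul, m2, ← hAM, ← hτσ]
    ring
  have hmt : meanTime (fun t => A * -deriv (fun t => S ((t - μf) / τ)) t) = μf := by
    unfold meanTime
    rw [v1, v0]; field_simp
  refine ⟨A, τ, fun t => S ((t - μf) / τ), fun t => I ((t - μf) / τ), hA, hτ,
    fun t => (hdS t).differentiableAt, fun t => (hdI t).differentiableAt, ?_, ?_, ?_, ?_,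
    ?_, ?_, ?_, v0, hmt, ?_⟩
  · intro t
    rw [(hdS t).deriv, hS']; ring
  · intro t
    rw [(hdI t).deriv, hI']; ring
  · refine hSlim.comp ?_
    exact (tendsto_atBot_add_const_right _ (-μf) tendsto_id).atBot_div_const hτ
  · intro t
    have := congrFun hF t
    rw [this]
    exact mul_nonneg (div_pos hA hτ).le (hnn _)
  · rw [e0]; exact comp_int_aux _ _ _ hτ (i0.const_mul _)
  · rw [e1]; exact comp_int_aux _ _ _ hτ ((i1.const_mul _).add (i0.const_mul _))
  · rw [e2]
    exact comp_int_aux _ _ _ hτ (((i2.const_mul _).add (i1.const_mul _)).add (i0.const_mul _))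
  · unfold stdDev
    rw [hmt, v3, v0, mul_div_cancel_right₀ _ hAf.ne', Real.sqrt_sq hσf.le]
end

section
/- (Theorem 2: good fits for the N-compartment SIR model.) Let N ≥ 1, let ρ : Fin N → Fin N → ℝ with ρ i j > 0, let τ : Fin N → ℝ with τ i > 0, and let p : Fin N → ℝ with p i > 0 and Σ_i p i = 1. Assume there exists a nonconstant solution (S, I) of the N-compartment SIR model with parameters ρ_{i,j} and τ_i (with boundary conditions S_i(t) → 1 as t → -∞), whose weighted incidence g₀(t) := -Σ_i p i · S_i'(t) is nonnegative, with g₀, t ↦ t·g₀(t), t ↦ t²·g₀(t) integrable, ∫ℝ g₀ > 0, finite mean time μ₀, and standard deviation σ₀ ∈ (0,∞). Then for every target triple (A_f, μ_f, σ_f) with A_f > 0, μ_f ∈ ℝ, σ_f > 0, there exist constants A > 0 and φ > 0 and a solution (S₁, I₁) of the N-compartment SIR model with parameters ρ_{i,j} and φ·τ_i (and the same boundary conditions) such that g(t) := -A·Σ_i p i · S₁_i'(t) satisfies ∫ℝ g = A_f, has mean time μ_f, and has standard deviation σ_f (i.e., g is a good fit to the target triple). -/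
open Filter MeasureTheory

lemma aux_int (F : ℝ → ℝ) (φ c : ℝ) (hφ : 0 < φ) :
    ∫ t, F ((t - c) / φ) = φ * ∫ t, F t := by
  have h := integral_sub_right_eq_self (μ := volume) (fun t => F (t / φ)) c
  rw [h, Measure.integral_comp_div F φ, abs_of_pos hφ, smul_eq_mul]

lemma aux_integrable (F : ℝ → ℝ) (φ c : ℝ) (hφ : 0 < φ) (hF : Integrable F) :
    Integrable (fun t => F ((t - c) / φ)) :=
  (hF.comp_div hφ.ne').comp_sub_right c

lemma aux_fit (g : ℝ → ℝ) (μ₀ σ₀ Af μf σf : ℝ) (h0 : Integrable g)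
    (h1 : Integrable (fun t => t * g t)) (h2 : Integrable (fun t => t ^ 2 * g t))
    (hpos : 0 < ∫ t, g t) (hmean : meanTime g = μ₀) (hσ₀ : 0 < σ₀) (hsd : stdDev g = σ₀)
    (hσf : 0 < σf) (φ c A : ℝ) (hφ : φ = σf / σ₀) (hc : c = μf - φ * μ₀)
    (hA : A = Af / ∫ t, g t) (hAf : 0 < Af) (G : ℝ → ℝ)
    (hG : G = fun t => A * (φ⁻¹ * g ((t - c) / φ))) :
    Integrable G ∧ Integrable (fun t => t * G t) ∧ Integrable (fun t => t ^ 2 * G t) ∧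
    (∫ t, G t) = Af ∧ meanTime G = μf ∧ stdDev G = σf := by
  have hφ0 : 0 < φ := by rw [hφ]; positivity
  have hA0 : 0 < A := by rw [hA]; positivity
  have e0 : G = fun t => (fun s => A * φ⁻¹ * g s) ((t - c) / φ) := by
    rw [hG]; funext t; simp only; ring
  have e1 : (fun t => t * G t) =
      fun t => (fun s => A * (s * g s) + A * φ⁻¹ * c * g s) ((t - c) / φ) := by
    rw [hG]; funext t; simp only; field_simp; ring
  have e2 : (fun t => t ^ 2 * G t) =
      fun t => (fun s => A * φ * (s ^ 2 * g s) + 2 * A * c * (s * g s)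
        + A * φ⁻¹ * c ^ 2 * g s) ((t - c) / φ) := by
    rw [hG]; funext t; simp only; field_simp; ring
  have i0 : (∫ t, G t) = Af := by
    rw [e0, aux_int (fun s => A * φ⁻¹ * g s) φ c hφ0, integral_const_mul, hA]
    field_simp
  have i1 : meanTime G = μf := by
    have hm : (∫ t, t * g t) = μ₀ * ∫ t, g t := by
      rw [← hmean, meanTime]; field_simp
    rw [meanTime, i0, e1, aux_int (fun s => A * (s * g s) + A * φ⁻¹ * c * g s) φ c hφ0,
      integral_add (h1.const_mul _) (h0.const_mul _), integral_const_mul, integral_const_mul,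
      hm, hA, hc]
    field_simp
    ring
  refine ⟨?_, ?_, ?_, i0, i1, ?_⟩
  · rw [e0]; exact aux_integrable _ φ c hφ0 (h0.const_mul _)
  · rw [e1]; exact aux_integrable _ φ c hφ0 ((h1.const_mul _).add (h0.const_mul _))
  · rw [e2]
    exact aux_integrable _ φ c hφ0
      (((h2.const_mul _).add (h1.const_mul _)).add (h0.const_mul _))
  · have e3 : (fun t => (t - μf) ^ 2 * G t) =
        fun t => (fun s => A * φ * ((s - μ₀) ^ 2 * g s)) ((t - c) / φ) := by
      rw [hG]; funext t; simp only
      have : t - μf = φ * ((t - c) / φ - μ₀) := by rw [hc]; field_simp; ring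
      rw [this]; field_simp
    rw [stdDev, i1, i0, e3, aux_int (fun s => A * φ * ((s - μ₀) ^ 2 * g s)) φ c hφ0,
      integral_const_mul]
    rw [stdDev, hmean] at hsd
    have : φ * (A * φ * ∫ t, (t - μ₀) ^ 2 * g t) / Af
        = φ ^ 2 * ((∫ t, (t - μ₀) ^ 2 * g t) / ∫ t, g t) := by
      rw [hA]; field_simp
    rw [this, Real.sqrt_mul (sq_nonneg _), hsd, Real.sqrt_sq hφ0.le, hφ]
    field_simp

/-- Theorem 2: if the N-compartment SIR model with parameters
`ρ i j` and `τ i` has a nonconstant solution whose weighted incidence is a nonnegative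
integrable density with positive total mass, finite mean time `μ₀` and standard
deviation `σ₀ ∈ (0,∞)`, then for every target triple `(A_f, μ_f, σ_f)` there exist
`A > 0`, `φ > 0` and a solution `(S₁, I₁)` of the model with parameters `ρ i j` and
`φ · τ i` whose scaled weighted incidence `g(t) = -A·∑ i, p i · S₁ i'(t)` is a good
fit: `∫ g = A_f`, `meanTime g = μ_f`, `stdDev g = σ_f`. -/
theorem sirN_good_fit_exists (N : ℕ) (hN : 1 ≤ N)
    (ρ : Fin N → Fin N → ℝ) (τ : Fin N → ℝ)
    (hρ : ∀ i j, 0 < ρ i j) (hτ : ∀ i, 0 < τ i)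
    (p : Fin N → ℝ) (hp : ∀ i, 0 < p i) (hpsum : ∑ i, p i = 1)
    (S I : ℝ → Fin N → ℝ)
    (hSd : ∀ i, Differentiable ℝ (fun t => S t i))
    (hId : ∀ i, Differentiable ℝ (fun t => I t i))
    (hS' : ∀ i t, deriv (fun s => S s i) t = -S t i * ∑ j, (ρ i j / τ j) * I t j)
    (hI' : ∀ i t, deriv (fun s => I s i) t =
      S t i * ∑ j, (ρ i j / τ j) * I t j - I t i / τ i)
    (hSlim : ∀ i, Tendsto (fun t => S t i) atBot (nhds 1))
    (hnc : ∃ t₁ t₂, S t₁ ≠ S t₂ ∨ I t₁ ≠ I t₂)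
    (hnn : ∀ t, 0 ≤ -∑ i, p i * deriv (fun s => S s i) t)
    (hint0 : Integrable (fun t => -∑ i, p i * deriv (fun s => S s i) t))
    (hint1 : Integrable (fun t => t * -∑ i, p i * deriv (fun s => S s i) t))
    (hint2 : Integrable (fun t => t ^ 2 * -∑ i, p i * deriv (fun s => S s i) t))
    (hpos : 0 < ∫ t, -∑ i, p i * deriv (fun s => S s i) t)
    (μ₀ : ℝ) (hmean : meanTime (fun t => -∑ i, p i * deriv (fun s => S s i) t) = μ₀)
    (σ₀ : ℝ) (hσ₀ : 0 < σ₀)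
    (hsd : stdDev (fun t => -∑ i, p i * deriv (fun s => S s i) t) = σ₀)
    (Af μf σf : ℝ) (hAf : 0 < Af) (hσf : 0 < σf) :
    ∃ (A φ : ℝ) (S₁ I₁ : ℝ → Fin N → ℝ), 0 < A ∧ 0 < φ ∧
      (∀ i, Differentiable ℝ (fun t => S₁ t i)) ∧
      (∀ i, Differentiable ℝ (fun t => I₁ t i)) ∧
      (∀ i t, deriv (fun s => S₁ s i) t =
        -S₁ t i * ∑ j, (ρ i j / (φ * τ j)) * I₁ t j) ∧
      (∀ i t, deriv (fun s => I₁ s i) t =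
        S₁ t i * ∑ j, (ρ i j / (φ * τ j)) * I₁ t j - I₁ t i / (φ * τ i)) ∧
      (∀ i, Tendsto (fun t => S₁ t i) atBot (nhds 1)) ∧
      (∀ t, 0 ≤ A * -∑ i, p i * deriv (fun s => S₁ s i) t) ∧
      Integrable (fun t => A * -∑ i, p i * deriv (fun s => S₁ s i) t) ∧
      Integrable (fun t => t * (A * -∑ i, p i * deriv (fun s => S₁ s i) t)) ∧
      Integrable (fun t => t ^ 2 * (A * -∑ i, p i * deriv (fun s => S₁ s i) t)) ∧
      (∫ t, A * -∑ i, p i * deriv (fun s => S₁ s i) t) = Af ∧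
      meanTime (fun t => A * -∑ i, p i * deriv (fun s => S₁ s i) t) = μf ∧
      stdDev (fun t => A * -∑ i, p i * deriv (fun s => S₁ s i) t) = σf := by
  set g : ℝ → ℝ := fun t => -∑ i, p i * deriv (fun s => S s i) t with hg
  obtain ⟨φ, hφ⟩ : ∃ φ, φ = σf / σ₀ := ⟨_, rfl⟩
  obtain ⟨c, hc⟩ : ∃ c, c = μf - φ * μ₀ := ⟨_, rfl⟩
  obtain ⟨A, hA⟩ : ∃ A, A = Af / ∫ t, g t := ⟨_, rfl⟩
  have hφ0 : 0 < φ := by rw [hφ]; positivity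
  have hA0 : 0 < A := by rw [hA]; exact div_pos hAf hpos
  have hu : ∀ t : ℝ, HasDerivAt (fun t : ℝ => (t - c) / φ) φ⁻¹ t := fun t => by
    simpa using ((hasDerivAt_id t).sub_const c).div_const φ
  have hSD : ∀ i t, HasDerivAt (fun t => S ((t - c) / φ) i)
      (deriv (fun s => S s i) ((t - c) / φ) * φ⁻¹) t := fun i t =>
    HasDerivAt.comp (h₂ := fun s => S s i) t (hSd i _).hasDerivAt (hu t)
  have hID : ∀ i t, HasDerivAt (fun t => I ((t - c) / φ) i)
      (deriv (fun s => I s i) ((t - c) / φ) * φ⁻¹) t := fun i t =>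
    HasDerivAt.comp (h₂ := fun s => I s i) t (hId i _).hasDerivAt (hu t)
  have hsum : ∀ i t, ∑ j, ρ i j / (φ * τ j) * I t j = φ⁻¹ * ∑ j, ρ i j / τ j * I t j := by
    intro i t
    rw [Finset.mul_sum]
    refine Finset.sum_congr rfl fun j _ => ?_
    have := (hτ j).ne'
    field_simp
  have hGe : (fun t => A * -∑ i, p i * deriv (fun s => S ((s - c) / φ) i) t)
      = fun t => A * (φ⁻¹ * g ((t - c) / φ)) := by
    funext t
    simp only [hg, (hSD _ _).deriv]
    rw [mul_neg φ⁻¹, Finset.mul_sum]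
    congr 2
    exact Finset.sum_congr rfl fun j _ => by ring
  refine ⟨A, φ, fun t => S ((t - c) / φ), fun t => I ((t - c) / φ), hA0, hφ0,
    fun i t => (hSD i t).differentiableAt, fun i t => (hID i t).differentiableAt,
    ?_, ?_, ?_, ?_, ?_⟩
  · intro i t
    rw [(hSD i t).deriv, hS', hsum]; ring
  · intro i t
    rw [(hID i t).deriv, hI', hsum]
    have := (hτ i).ne'
    field_simp
  · intro i
    refine (hSlim i).comp ?_
    exact (tendsto_atBot_add_const_right _ (-c) tendsto_id).atBot_div_const hφ0
  · intro t
    have h := congrFun hGe t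
    simp only at h ⊢
    rw [h]
    have := hnn ((t - c) / φ)
    positivity
  · exact aux_fit g μ₀ σ₀ Af μf σf hint0 hint1 hint2 hpos hmean hσ₀ hsd hσf φ c A hφ hc hA hAf
      _ hGe
end
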